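/- Let A and B be finite nonempty sets and let f : A → ℝ and g : B → ℝ be positive functions. Then there exist a function h : A × B → ℝ with h ≥ 0 and functions r_A : A → ℝ, r_B : B → ℝ with r_A, r_B ≥ 0 such that: (1) for every a ∈ A, Σ_{b∈B} h(a,b) + r_A(a) = f(a), and for every b ∈ B, Σ_{a∈A} h(a,b) + r_B(b) = g(b); (2) the number of pairs (a,b) with h(a,b) > 0 plus the number of elements x with r_A(x) > 0 or r_B(x) > 0 is at most |A| + |B|; (3) Σ_{(a,b)} h(a,b) = min( Σ_{a∈A} f(a), Σ_{b∈B} g(b) ). -/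

import Mathlib

/-- A greedy matching between nonnegative demands: every step matches a pair of elements with
positive demand and exhausts at least one of them. -/
theorem exists_b_matching_of_nonneg {A B : Type*} [Fintype A] [Fintype B]
    (f : A → ℝ) (g : B → ℝ) (hf : ∀ a, 0 ≤ f a) (hg : ∀ b, 0 ≤ g b) :
    ∃ (h : A × B → ℝ) (rA : A → ℝ) (rB : B → ℝ),
      (∀ p, 0 ≤ h p) ∧ (∀ a, 0 ≤ rA a) ∧ (∀ b, 0 ≤ rB b) ∧
      (∀ a, (∑ b, h (a, b)) + rA a = f a) ∧
      (∀ b, (∑ a, h (a, b)) + rB b = g b) ∧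
      ((Finset.univ.filter fun p : A × B => 0 < h p).card
          + (Finset.univ.filter fun a : A => 0 < rA a).card
          + (Finset.univ.filter fun b : B => 0 < rB b).card
        ≤ (Finset.univ.filter fun a : A => 0 < f a).card
          + (Finset.univ.filter fun b : B => 0 < g b).card) ∧
      (∑ p : A × B, h p) = min (∑ a, f a) (∑ b, g b) := by
  classical
  induction hn : (Finset.univ.filter fun a : A => 0 < f a).card
      + (Finset.univ.filter fun b : B => 0 < g b).card
    using Nat.strong_induction_on generalizing f g with
  | _ n ih =>
  subst hn
  by_cases hpos : (∃ a, 0 < f a) ∧ ∃ b, 0 < g b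
  · obtain ⟨⟨a₀, ha₀⟩, b₀, hb₀⟩ := hpos
    obtain ⟨m, hm⟩ : ∃ m, m = min (f a₀) (g b₀) := ⟨_, rfl⟩
    have hm0 : 0 < m := hm ▸ lt_min ha₀ hb₀
    have hmf : m ≤ f a₀ := hm ▸ min_le_left _ _
    have hmg : m ≤ g b₀ := hm ▸ min_le_right _ _
    have hf' : ∀ a, 0 ≤ (f - Pi.single a₀ m : A → ℝ) a := by
      intro a
      by_cases h : a = a₀
      · subst h; simpa using hmf
      · simpa [h] using hf a
    have hg' : ∀ b, 0 ≤ (g - Pi.single b₀ m : B → ℝ) b := by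
      intro b
      by_cases h : b = b₀
      · subst h; simpa using hmg
      · simpa [h] using hg b
    have hsf : (Finset.univ.filter fun a => 0 < (f - Pi.single a₀ m : A → ℝ) a)
        ⊆ Finset.univ.filter fun a => 0 < f a := by
      intro a
      by_cases h : a = a₀
      · subst h; simp [ha₀]
      · simp [h]
    have hsg : (Finset.univ.filter fun b => 0 < (g - Pi.single b₀ m : B → ℝ) b)
        ⊆ Finset.univ.filter fun b => 0 < g b := by
      intro b
      by_cases h : b = b₀
      · subst h; simp [hb₀]
      · simp [h]
    have hlt : (Finset.univ.filter fun a => 0 < (f - Pi.single a₀ m : A → ℝ) a).card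
          + (Finset.univ.filter fun b => 0 < (g - Pi.single b₀ m : B → ℝ) b).card
        < (Finset.univ.filter fun a => 0 < f a).card
          + (Finset.univ.filter fun b => 0 < g b).card := by
      rcases min_choice (f a₀) (g b₀) with h | h
      · refine add_lt_add_of_lt_of_le (Finset.card_lt_card ?_) (Finset.card_le_card hsg)
        refine (Finset.ssubset_iff_of_subset hsf).2 ⟨a₀, by simp [ha₀], ?_⟩
        simp [hm, h]
      · refine add_lt_add_of_le_of_lt (Finset.card_le_card hsf) (Finset.card_lt_card ?_)
        refine (Finset.ssubset_iff_of_subset hsg).2 ⟨b₀, by simp [hb₀], ?_⟩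
        simp [hm, h]
    obtain ⟨h, rA, rB, hh, hrA, hrB, hA, hB, hcard, hsum⟩ := ih _ hlt _ _ hf' hg' rfl
    refine ⟨h + Pi.single (a₀, b₀) m, rA, rB, ?_, hrA, hrB, ?_, ?_, ?_, ?_⟩
    · exact fun p => add_nonneg (hh p) ((Pi.single_nonneg.2 hm0.le : (0 : A × B → ℝ) ≤ _) p)
    · intro a
      have hs : ∑ b, (Pi.single (a₀, b₀) m : A × B → ℝ) (a, b)
          = (Pi.single a₀ m : A → ℝ) a := by
        by_cases h : a = a₀ <;> simp [Pi.single_apply, h]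
      have := hA a
      simp only [Pi.add_apply, Pi.sub_apply, Finset.sum_add_distrib, hs] at this ⊢
      linarith
    · intro b
      have hs : ∑ a, (Pi.single (a₀, b₀) m : A × B → ℝ) (a, b)
          = (Pi.single b₀ m : B → ℝ) b := by
        by_cases h : b = b₀ <;> simp [Pi.single_apply, h]
      have := hB b
      simp only [Pi.add_apply, Pi.sub_apply, Finset.sum_add_distrib, hs] at this ⊢
      linarith
    · have hsub : (Finset.univ.filter fun p => 0 < (h + Pi.single (a₀, b₀) m : A × B → ℝ) p)
          ⊆ insert (a₀, b₀) (Finset.univ.filter fun p => 0 < h p) := by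
        intro p
        by_cases hp : p = (a₀, b₀)
        · simp [hp]
        · simp [hp]
      have := (Finset.card_le_card hsub).trans (Finset.card_insert_le _ _)
      omega
    · simp only [Pi.add_apply, Pi.sub_apply, Finset.sum_add_distrib, Finset.sum_sub_distrib,
        Finset.sum_pi_single', Finset.mem_univ, if_true] at hsum ⊢
      rw [hsum, min_sub_sub_right]
      simp
  · refine ⟨0, f, g, by simp, hf, hg, by simp, by simp, by simp, ?_⟩
    rcases not_and_or.1 hpos with h | h <;> push Not at h
    · have hf0 : ∑ a, f a = 0 := Finset.sum_eq_zero fun a _ => le_antisymm (h a) (hf a)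
      simpa [hf0] using Finset.sum_nonneg fun b _ => hg b
    · have hg0 : ∑ b, g b = 0 := Finset.sum_eq_zero fun b _ => le_antisymm (h b) (hg b)
      simpa [hg0] using Finset.sum_nonneg fun a _ => hf a


/-- **Maximal fractional `b`-matching between two demand sequences
(Proposition `bmatching`).**
Given finite nonempty sets `A`, `B` and positive demands `f : A → ℝ`, `g : B → ℝ`, there
exist a nonnegative fractional matching `h : A × B → ℝ` and nonnegative residuals
`rA : A → ℝ`, `rB : B → ℝ` such that
(1) every demand is exactly accounted for,
(2) the number of matched pairs plus the number of elements with positive residual is at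
most `|A| + |B|`, and
(3) the total matched mass equals `min (Σ f, Σ g)`. -/
theorem maximal_b_matching {A B : Type*} [Fintype A] [Fintype B]
    [Nonempty A] [Nonempty B]
    (f : A → ℝ) (g : B → ℝ) (hf : ∀ a, 0 < f a) (hg : ∀ b, 0 < g b) :
    ∃ (h : A × B → ℝ) (rA : A → ℝ) (rB : B → ℝ),
      (∀ p, 0 ≤ h p) ∧ (∀ a, 0 ≤ rA a) ∧ (∀ b, 0 ≤ rB b) ∧
      (∀ a, (∑ b, h (a, b)) + rA a = f a) ∧
      (∀ b, (∑ a, h (a, b)) + rB b = g b) ∧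
      ((Finset.univ.filter fun p : A × B => 0 < h p).card
          + (Finset.univ.filter fun a : A => 0 < rA a).card
          + (Finset.univ.filter fun b : B => 0 < rB b).card
        ≤ Fintype.card A + Fintype.card B) ∧
      (∑ p : A × B, h p) = min (∑ a, f a) (∑ b, g b) := by
  simpa [hf, hg] using exists_b_matching_of_nonneg f g (fun a => (hf a).le) fun b => (hg b).le
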